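/- arXiv:2305.12292 — 9 statements merged into one kernel-verified Lean document; each statement's English description precedes it below -/
import Mathlib

section
/- (Validity part of Proposition 1.) Let n ≥ 1 and let x, u, û ∈ ℝⁿ satisfy |uᵀx| ≤ 1 and |ûᵀx| ≤ 1, and set Y := u uᵀ (an n×n matrix). Then at least one of the following two alternatives holds: (a) −1 ≤ uᵀx ≤ ûᵀx and xᵀYx ≤ (ûᵀx)(uᵀx) + (û − u)ᵀx; or (b) ûᵀx ≤ uᵀx ≤ 1 and xᵀYx ≤ (ûᵀx)(uᵀx) + (u − û)ᵀx. In other words, every pair (u, Y) with Y = u uᵀ satisfies the two-term eigenvector disjunction generated by (û, x). -/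
open Matrix

/-- Validity part of Proposition 1: every pair `(u, Y)` with `Y = u uᵀ` satisfies
the two-term eigenvector disjunction generated by `(uhat, x)`. -/
theorem rank_one_disjunction_valid (n : ℕ) (hn : 1 ≤ n) (x u uhat : Fin n → ℝ)
    (hu : |u ⬝ᵥ x| ≤ 1) (huhat : |uhat ⬝ᵥ x| ≤ 1) :
    ((-1 ≤ u ⬝ᵥ x ∧ u ⬝ᵥ x ≤ uhat ⬝ᵥ x) ∧
      x ⬝ᵥ (Matrix.vecMulVec u u).mulVec x ≤ (uhat ⬝ᵥ x) * (u ⬝ᵥ x) + (uhat - u) ⬝ᵥ x) ∨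
    ((uhat ⬝ᵥ x ≤ u ⬝ᵥ x ∧ u ⬝ᵥ x ≤ 1) ∧
      x ⬝ᵥ (Matrix.vecMulVec u u).mulVec x ≤ (uhat ⬝ᵥ x) * (u ⬝ᵥ x) + (u - uhat) ⬝ᵥ x) := by
  have key : x ⬝ᵥ (Matrix.vecMulVec u u).mulVec x = (u ⬝ᵥ x) * (u ⬝ᵥ x) := by
    rw [Matrix.dotProduct_mulVec, Matrix.vecMul_vecMulVec, smul_dotProduct, smul_eq_mul,
      dotProduct_comm x u]
  rw [key, sub_dotProduct, sub_dotProduct]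
  obtain ⟨h1, h2⟩ := abs_le.mp hu
  rcases le_total (u ⬝ᵥ x) (uhat ⬝ᵥ x) with h | h
  · left
    refine ⟨⟨h1, h⟩, ?_⟩
    nlinarith [mul_nonneg (sub_nonneg.mpr h) (sub_nonneg.mpr h1)]
  · right
    refine ⟨⟨h, h2⟩, ?_⟩
    nlinarith [mul_nonneg (sub_nonneg.mpr h) (sub_nonneg.mpr h2)]
end

section
/- (Validity part of Corollary 1.) Let n, k ≥ 1, let x ∈ ℝⁿ with ‖x‖₂ = 1, and let U, Û ∈ ℝ^{n×k} with columns U₁,…,U_k and Û₁,…,Û_k. Assume UUᵀ ⪯ I (the n×n identity) and |xᵀÛⱼ| ≤ 1 for every j ∈ [k], and set Y := UUᵀ. Then there exists a subset L ⊆ [k] such that: (i) −1 ≤ xᵀUⱼ ≤ xᵀÛⱼ for every j ∈ L; (ii) xᵀÛⱼ ≤ xᵀUⱼ ≤ 1 for every j ∈ [k]\L; and (iii) xᵀYx ≤ Σ_{j∈L} [ (xᵀUⱼ)(xᵀÛⱼ) + (Ûⱼ − Uⱼ)ᵀx ] + Σ_{j∈[k]\L} [ (xᵀUⱼ)(xᵀÛⱼ)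 + (Uⱼ − Ûⱼ)ᵀx ]. -/
open Matrix

/-- Validity part of Corollary 1: every pair `(U, Y)` with `Y = U Uᵀ ⪯ I` satisfies some
region of the `2^k`-term eigenvector disjunction generated by `(Uhat, x)`. -/
theorem rank_k_disjunction_valid (n k : ℕ) (hn : 1 ≤ n) (hk : 1 ≤ k)
    (x : Fin n → ℝ) (hx : Real.sqrt (∑ i, x i ^ 2) = 1)
    (U Uhat : Matrix (Fin n) (Fin k) ℝ)
    (hU : (1 - U * Uᵀ).PosSemidef)
    (hUhat : ∀ j : Fin k, |x ⬝ᵥ (fun i => Uhat i j)| ≤ 1) :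
    ∃ L : Finset (Fin k),
      (∀ j ∈ L, -1 ≤ x ⬝ᵥ (fun i => U i j) ∧
        x ⬝ᵥ (fun i => U i j) ≤ x ⬝ᵥ (fun i => Uhat i j)) ∧
      (∀ j ∉ L, x ⬝ᵥ (fun i => Uhat i j) ≤ x ⬝ᵥ (fun i => U i j) ∧
        x ⬝ᵥ (fun i => U i j) ≤ 1) ∧
      x ⬝ᵥ (U * Uᵀ).mulVec x ≤
        (∑ j ∈ L, ((x ⬝ᵥ (fun i => U i j)) * (x ⬝ᵥ (fun i => Uhat i j))
            + (fun i => Uhat i j - U i j) ⬝ᵥ x))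
        + ∑ j ∈ Lᶜ, ((x ⬝ᵥ (fun i => U i j)) * (x ⬝ᵥ (fun i => Uhat i j))
            + (fun i => U i j - Uhat i j) ⬝ᵥ x) := by
  have hx2 : ∑ i, x i ^ 2 = 1 := by
    rwa [Real.sqrt_eq_one] at hx
  obtain ⟨a, ha⟩ : ∃ a : Fin k → ℝ, ∀ j, x ⬝ᵥ (fun i => U i j) = a j := ⟨_, fun _ => rfl⟩
  obtain ⟨b, hb⟩ : ∃ b : Fin k → ℝ, ∀ j, x ⬝ᵥ (fun i => Uhat i j) = b j := ⟨_, fun _ => rfl⟩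
  have h1 : ∀ j, (fun i => Uhat i j - U i j) ⬝ᵥ x = b j - a j := by
    intro j
    rw [← ha, ← hb, ← dotProduct_sub, dotProduct_comm]
    rfl
  have h2 : ∀ j, (fun i => U i j - Uhat i j) ⬝ᵥ x = a j - b j := by
    intro j
    rw [← ha, ← hb, ← dotProduct_sub, dotProduct_comm]
    rfl
  have hY : x ⬝ᵥ (U * Uᵀ).mulVec x = ∑ j, a j ^ 2 := by
    rw [← mulVec_mulVec, dotProduct_mulVec, mulVec_transpose]
    simp only [dotProduct, sq, ← ha]
    rfl
  have hle : ∑ j, a j ^ 2 ≤ 1 := by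
    have h := hU.dotProduct_mulVec_nonneg x
    rw [sub_mulVec, dotProduct_sub, one_mulVec, star_trivial, hY] at h
    have : x ⬝ᵥ x = 1 := by
      rw [← hx2]; simp only [dotProduct, sq]
    linarith
  have haj : ∀ j, -1 ≤ a j ∧ a j ≤ 1 := by
    intro j
    have h : a j ^ 2 ≤ ∑ j, a j ^ 2 :=
      Finset.single_le_sum (f := fun j => a j ^ 2) (fun i _ => sq_nonneg _) (Finset.mem_univ j)
    exact abs_le.mp ((sq_le_one_iff_abs_le_one _).mp (h.trans hle))
  simp only [ha, hb, h1, h2, hY]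
  refine ⟨Finset.univ.filter (fun j => a j ≤ b j), ?_, ?_, ?_⟩
  · intro j hj
    exact ⟨(haj j).1, by simpa using hj⟩
  · intro j hj
    have : b j < a j := by simpa using hj
    exact ⟨this.le, (haj j).2⟩
  · rw [← Finset.sum_add_sum_compl (Finset.univ.filter (fun j => a j ≤ b j)) (fun j => a j ^ 2)]
    refine add_le_add (Finset.sum_le_sum ?_) (Finset.sum_le_sum ?_)
    · intro j hj
      have h : a j ≤ b j := by simpa using hj
      nlinarith [mul_nonneg (sub_nonneg.2 h) (by linarith [(haj j).1] : 0 ≤ a j + 1)]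
    · intro j hj
      have h : b j < a j := by simpa using hj
      nlinarith [mul_nonneg (sub_nonneg.2 h.le) (sub_nonneg.2 (haj j).2)]
end

section
/- (Proposition 2: a single McCormick disjunction per column does not cut off any relaxation-feasible point.) Let n, k ≥ 1 with n ≥ k + 2. Let U ∈ ℝ^{n×k} and let Y be a real symmetric n×n matrix with Y ⪯ I and Y ⪰ UUᵀ. For each j ∈ [k] let i(j) ∈ [n] and let ℓⱼ, rⱼ ∈ ℝ with −1 ≤ ℓⱼ ≤ U_{i(j),j} ≤ rⱼ ≤ 1. For each pair (i,j) define bounds [a_{i,j}, b_{i,j}] := [ℓⱼ, rⱼ] if i = i(j) and [a_{i,j}, b_{i,j}] := [−1, 1] otherwise. Then there exists V : [n]×[k]×[k] → ℝ such that: (i) Σ_{i=1}^n V_{i,j,j} = 1 for all j ∈ [k]; (ii) Σ_{i=1}^n V_{i,j₁,j₂} = 0 for all j₁ ≠ j₂ in [k]; and (iii) for all i ∈ [n] and j₁, j₂ ∈ [k], writing a = a_{i,j₁}, b = b_{i,j₁}, c = a_{i,j₂}, d = b_{i,j₂}, the McCormick inequalities hold: a·U_{i,j₂} + c·U_{i,j₁}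 − a·c ≤ V_{i,j₁,j₂}, b·U_{i,j₂} + d·U_{i,j₁} − b·d ≤ V_{i,j₁,j₂}, V_{i,j₁,j₂} ≤ c·U_{i,j₁} + b·U_{i,j₂} − b·c, and V_{i,j₁,j₂} ≤ d·U_{i,j₁} + a·U_{i,j₂} − a·d. Consequently, adding one McCormick disjunction per column of U to the lifted matrix perspective relaxation does not change its optimal value. -/
open Matrix

theorem exists_sum_between {n : ℕ} (lo hi : Fin n → ℝ) (c : ℝ) (h : ∀ i, lo i ≤ hi i)
    (h1 : ∑ i, lo i ≤ c) (h2 : c ≤ ∑ i, hi i) :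
    ∃ f : Fin n → ℝ, ∑ i, f i = c ∧ ∀ i, lo i ≤ f i ∧ f i ≤ hi i := by
  rcases eq_or_lt_of_le (h1.trans h2) with he | hlt
  · exact ⟨lo, by linarith, fun i => ⟨le_rfl, h i⟩⟩
  · set L := ∑ i, lo i with hL
    set H := ∑ i, hi i with hH
    have hpos : 0 < H - L := by linarith
    have ht0 : 0 ≤ (c - L) / (H - L) := div_nonneg (by linarith) hpos.le
    have ht1 : (c - L) / (H - L) ≤ 1 := (div_le_one hpos).2 (by linarith)
    have htm : (c - L) / (H - L) * (H - L) = c - L := div_mul_cancel₀ _ hpos.ne'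
    generalize (c - L) / (H - L) = t at ht0 ht1 htm
    refine ⟨fun i => lo i + t * (hi i - lo i), ?_, fun i => ⟨?_, ?_⟩⟩
    · rw [Finset.sum_add_distrib, ← Finset.mul_sum, Finset.sum_sub_distrib, ← hL, ← hH]
      linarith
    · nlinarith [h i]
    · nlinarith [h i]

theorem contraction_bound {n k : ℕ} (U : Matrix (Fin n) (Fin k) ℝ) (Y : Matrix (Fin n) (Fin n) ℝ)
    (hYI : (1 - Y).PosSemidef) (hYU : (Y - U * Uᵀ).PosSemidef) (v : Fin k → ℝ) :
    (U *ᵥ v) ⬝ᵥ (U *ᵥ v) ≤ v ⬝ᵥ v := by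
  have hP : (1 - U * Uᵀ).PosSemidef := by
    have := hYI.add hYU
    simpa using this
  have h1 := hP.dotProduct_mulVec_nonneg (U *ᵥ v)
  set w := U *ᵥ v with hw
  have e1 : w ⬝ᵥ ((U * Uᵀ) *ᵥ w) = (Uᵀ *ᵥ w) ⬝ᵥ (Uᵀ *ᵥ w) := by
    rw [← Matrix.mulVec_mulVec, Matrix.dotProduct_mulVec, ← Matrix.mulVec_transpose]
  have e2 : v ⬝ᵥ (Uᵀ *ᵥ w) = w ⬝ᵥ w := by
    rw [Matrix.dotProduct_mulVec, Matrix.vecMul_transpose]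
  simp only [star_trivial, Matrix.sub_mulVec, Matrix.one_mulVec, dotProduct_sub, e1] at h1
  have h2 : 0 ≤ (v - Uᵀ *ᵥ w) ⬝ᵥ (v - Uᵀ *ᵥ w) :=
    Finset.sum_nonneg fun i _ => mul_self_nonneg _
  rw [sub_dotProduct, dotProduct_sub, dotProduct_sub, dotProduct_comm (Uᵀ *ᵥ w) v, e2] at h2
  linarith

theorem mccormick_point {x y a b c d : ℝ} (h1 : a ≤ x) (h2 : x ≤ b) (h3 : c ≤ y) (h4 : y ≤ d) :
    max (a * y + c * x - a * c) (b * y + d * x - b * d) ≤ x * y ∧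
    x * y ≤ min (c * x + b * y - b * c) (d * x + a * y - a * d) := by
  refine ⟨max_le ?_ ?_, le_min ?_ ?_⟩
  · nlinarith [mul_nonneg (sub_nonneg.2 h1) (sub_nonneg.2 h3)]
  · nlinarith [mul_nonneg (sub_nonneg.2 h2) (sub_nonneg.2 h4)]
  · nlinarith [mul_nonneg (sub_nonneg.2 h2) (sub_nonneg.2 h3)]
  · nlinarith [mul_nonneg (sub_nonneg.2 h1) (sub_nonneg.2 h4)]

/-- Proposition 2: a single McCormick disjunction per column of `U` does not cut off any
relaxation-feasible point: any `(U, Y)` feasible for the lifted matrix perspective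
relaxation, lying in the branch `U_{i(j),j} ∈ [ℓⱼ, rⱼ]` of each column's disjunction,
can be completed by product variables `V` satisfying all McCormick inequalities together
with the equality constraints `Σᵢ V_{i,j,j} = 1` and `Σᵢ V_{i,j₁,j₂} = 0` for `j₁ ≠ j₂`. -/
theorem mccormick_single_disjunction_useless (n k : ℕ) (hn : 1 ≤ n) (hk : 1 ≤ k)
    (hnk : k + 2 ≤ n)
    (U : Matrix (Fin n) (Fin k) ℝ) (Y : Matrix (Fin n) (Fin n) ℝ)
    (hYsymm : Y.IsSymm) (hYI : (1 - Y).PosSemidef) (hYU : (Y - U * Uᵀ).PosSemidef)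
    (idx : Fin k → Fin n) (l r : Fin k → ℝ)
    (hb : ∀ j : Fin k, -1 ≤ l j ∧ l j ≤ U (idx j) j ∧ U (idx j) j ≤ r j ∧ r j ≤ 1) :
    ∃ V : Fin n → Fin k → Fin k → ℝ,
      (∀ j : Fin k, ∑ i, V i j j = 1) ∧
      (∀ j₁ j₂ : Fin k, j₁ ≠ j₂ → ∑ i, V i j₁ j₂ = 0) ∧
      (∀ (i : Fin n) (j₁ j₂ : Fin k),
        (if i = idx j₁ then l j₁ else -1) * U i j₂
            + (if i = idx j₂ then l j₂ else -1) * U i j₁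
            - (if i = idx j₁ then l j₁ else -1) * (if i = idx j₂ then l j₂ else -1)
          ≤ V i j₁ j₂ ∧
        (if i = idx j₁ then r j₁ else 1) * U i j₂
            + (if i = idx j₂ then r j₂ else 1) * U i j₁
            - (if i = idx j₁ then r j₁ else 1) * (if i = idx j₂ then r j₂ else 1)
          ≤ V i j₁ j₂ ∧
        V i j₁ j₂ ≤ (if i = idx j₂ then l j₂ else -1) * U i j₁
            + (if i = idx j₁ then r j₁ else 1) * U i j₂
            - (if i = idx j₁ then r j₁ else 1) * (if i = idx j₂ then l j₂ else -1) ∧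
        V i j₁ j₂ ≤ (if i = idx j₂ then r j₂ else 1) * U i j₁
            + (if i = idx j₁ then l j₁ else -1) * U i j₂
            - (if i = idx j₁ then l j₁ else -1) * (if i = idx j₂ then r j₂ else 1)) := by
  have hcol : ∀ j, ∑ i, U i j ^ 2 ≤ 1 := by
    intro j
    have := contraction_bound U Y hYI hYU (Pi.single j 1)
    simpa [dotProduct, pow_two, Pi.single_apply] using this
  have hpair : ∀ j₁ j₂, j₁ ≠ j₂ → ∀ e : ℝ, e ^ 2 = 1 → ∑ i, (U i j₁ + e * U i j₂) ^ 2 ≤ 2 := by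
    intro j₁ j₂ hj e he
    have := contraction_bound U Y hYI hYU (Pi.single j₁ 1 + e • Pi.single j₂ 1)
    simp only [Matrix.mulVec_add, Matrix.mulVec_smul, Matrix.mulVec_single_one, add_dotProduct,
      dotProduct_add, smul_dotProduct, dotProduct_smul, single_one_dotProduct,
      Pi.single_eq_same, Pi.single_eq_of_ne hj, Pi.single_eq_of_ne hj.symm, smul_eq_mul] at this
    have hs : ∑ i, (U i j₁ + e * U i j₂) ^ 2 = ∑ i, U i j₁ * U i j₁ +
        e * ∑ i, U i j₁ * U i j₂ + e * (∑ i, U i j₂ * U i j₁ + e * ∑ i, U i j₂ * U i j₂) := by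
      simp only [Finset.mul_sum, ← Finset.sum_add_distrib]
      exact Finset.sum_congr rfl fun i _ => by ring
    simp only [dotProduct, Matrix.col_apply] at this
    nlinarith [this, hs]
  have habs : ∀ i j, -1 ≤ U i j ∧ U i j ≤ 1 := by
    intro i j
    have h1 : U i j ^ 2 ≤ ∑ i, U i j ^ 2 :=
      Finset.single_le_sum (f := fun i => U i j ^ 2) (fun i _ => sq_nonneg _) (Finset.mem_univ i)
    exact abs_le.1 ((sq_le_one_iff_abs_le_one _).1 (h1.trans (hcol j)))
  let a : Fin n → Fin k → ℝ := fun i j => if i = idx j then l j else -1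
  let b : Fin n → Fin k → ℝ := fun i j => if i = idx j then r j else 1
  have hab : ∀ i j, a i j ≤ U i j ∧ U i j ≤ b i j := by
    intro i j
    by_cases h : i = idx j
    · subst h
      simpa [a, b] using ⟨(hb j).2.1, (hb j).2.2.1⟩
    · simpa [a, b, h] using habs i j
  let lo : Fin k → Fin k → Fin n → ℝ := fun j₁ j₂ i =>
    max (a i j₁ * U i j₂ + a i j₂ * U i j₁ - a i j₁ * a i j₂)
      (b i j₁ * U i j₂ + b i j₂ * U i j₁ - b i j₁ * b i j₂)
  let hi : Fin k → Fin k → Fin n → ℝ := fun j₁ j₂ i =>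
    min (a i j₂ * U i j₁ + b i j₁ * U i j₂ - b i j₁ * a i j₂)
      (b i j₂ * U i j₁ + a i j₁ * U i j₂ - a i j₁ * b i j₂)
  have hM : ∀ j₁ j₂ i, lo j₁ j₂ i ≤ U i j₁ * U i j₂ ∧ U i j₁ * U i j₂ ≤ hi j₁ j₂ i :=
    fun j₁ j₂ i => mccormick_point (hab i j₁).1 (hab i j₁).2 (hab i j₂).1 (hab i j₂).2
  have hnR : (k : ℝ) + 2 ≤ n := by exact_mod_cast hnk
  have hkR : (1 : ℝ) ≤ k := by exact_mod_cast hk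
  have key : ∀ j₁ j₂, ∃ f : Fin n → ℝ, ∑ i, f i = (if j₁ = j₂ then 1 else 0) ∧
      ∀ i, lo j₁ j₂ i ≤ f i ∧ f i ≤ hi j₁ j₂ i := by
    intro j₁ j₂
    refine exists_sum_between _ _ _ (fun i => (hM j₁ j₂ i).1.trans (hM j₁ j₂ i).2) ?_ ?_
    · by_cases hj : j₁ = j₂
      · subst hj
        rw [if_pos rfl]
        refine (Finset.sum_le_sum fun i _ => (hM j₁ j₁ i).1).trans ?_
        simpa [pow_two] using hcol j₁
      · rw [if_neg hj]
        have hk2 : (2 : ℝ) ≤ k := by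
          have : 2 ≤ k := by
            have h1 := j₁.isLt
            have h2 := j₂.isLt
            have h3 : j₁.val ≠ j₂.val := fun h => hj (Fin.ext h)
            omega
          exact_mod_cast this
        have hle : ∀ i, lo j₁ j₂ i ≤ (U i j₁ + 1 * U i j₂) ^ 2 / 2 -
            (1 - (if i = idx j₁ then 1 else 0) - (if i = idx j₂ then 1 else 0)) / 2 := by
          intro i
          by_cases h : i = idx j₁ ∨ i = idx j₂
          · refine (hM j₁ j₂ i).1.trans ?_
            have : (1 : ℝ) ≤ (if i = idx j₁ then 1 else 0) + (if i = idx j₂ then 1 else 0) := by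
              rcases h with h | h
              · rw [if_pos h]; split_ifs <;> norm_num
              · rw [if_pos h]; split_ifs <;> norm_num
            nlinarith [sq_nonneg (U i j₁), sq_nonneg (U i j₂)]
          · push Not at h
            simp only [lo, a, b, if_neg h.1, if_neg h.2]
            refine max_le ?_ ?_
            · nlinarith [sq_nonneg (U i j₁ + U i j₂ + 1)]
            · nlinarith [sq_nonneg (U i j₁ + U i j₂ - 1)]
        refine (Finset.sum_le_sum fun i _ => hle i).trans ?_
        rw [Finset.sum_sub_distrib, ← Finset.sum_div, ← Finset.sum_div, Finset.sum_sub_distrib,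
          Finset.sum_sub_distrib]
        have := hpair j₁ j₂ hj 1 (by norm_num)
        simp only [Finset.sum_ite_eq', Finset.sum_ite_eq, Finset.mem_univ, if_true, Finset.sum_const,
          Finset.card_univ, Fintype.card_fin, nsmul_eq_mul, mul_one]
        linarith
    · by_cases hj : j₁ = j₂
      · subst hj
        rw [if_pos rfl]
        have hle : ∀ i, 1 - (if i = idx j₁ then 1 else 0) ≤ hi j₁ j₁ i := by
          intro i
          by_cases h : i = idx j₁
          · refine le_trans ?_ (hM j₁ j₁ i).2
            rw [if_pos h]
            nlinarith [mul_self_nonneg (U i j₁)]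
          · simp only [hi, a, b, if_neg h]
            refine le_min ?_ ?_ <;> linarith
        refine le_trans ?_ (Finset.sum_le_sum fun i _ => hle i)
        rw [Finset.sum_sub_distrib]
        simp only [Finset.sum_ite_eq', Finset.sum_ite_eq, Finset.mem_univ, if_true, Finset.sum_const,
          Finset.card_univ, Fintype.card_fin, nsmul_eq_mul, mul_one]
        linarith
      · rw [if_neg hj]
        have hk2 : (2 : ℝ) ≤ k := by
          have : 2 ≤ k := by
            have h1 := j₁.isLt
            have h2 := j₂.isLt
            have h3 : j₁.val ≠ j₂.val := fun h => hj (Fin.ext h)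
            omega
          exact_mod_cast this
        have hle : ∀ i, (1 - (if i = idx j₁ then 1 else 0) - (if i = idx j₂ then 1 else 0)) / 2 -
            (U i j₁ + (-1) * U i j₂) ^ 2 / 2 ≤ hi j₁ j₂ i := by
          intro i
          by_cases h : i = idx j₁ ∨ i = idx j₂
          · refine le_trans ?_ (hM j₁ j₂ i).2
            have : (1 : ℝ) ≤ (if i = idx j₁ then 1 else 0) + (if i = idx j₂ then 1 else 0) := by
              rcases h with h | h
              · rw [if_pos h]; split_ifs <;> norm_num
              · rw [if_pos h]; split_ifs <;> norm_num
            nlinarith [sq_nonneg (U i j₁), sq_nonneg (U i j₂)]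
          · push Not at h
            simp only [hi, a, b, if_neg h.1, if_neg h.2]
            refine le_min ?_ ?_
            · nlinarith [sq_nonneg (U i j₁ - U i j₂ - 1)]
            · nlinarith [sq_nonneg (U i j₁ - U i j₂ + 1)]
        refine le_trans ?_ (Finset.sum_le_sum fun i _ => hle i)
        rw [Finset.sum_sub_distrib, ← Finset.sum_div, ← Finset.sum_div, Finset.sum_sub_distrib,
          Finset.sum_sub_distrib]
        have := hpair j₁ j₂ hj (-1) (by norm_num)
        simp only [Finset.sum_ite_eq', Finset.sum_ite_eq, Finset.mem_univ, if_true, Finset.sum_const,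
          Finset.card_univ, Fintype.card_fin, nsmul_eq_mul, mul_one]
        linarith
  choose f hf hfb using key
  refine ⟨fun i j₁ j₂ => f j₁ j₂ i, fun j => ?_, fun j₁ j₂ hj => ?_, fun i j₁ j₂ => ?_⟩
  · simpa using hf j j
  · simpa [hj] using hf j₁ j₂
  · have h := hfb j₁ j₂ i
    exact ⟨(le_max_left _ _).trans h.1, (le_max_right _ _).trans h.1,
      h.2.trans (min_le_left _ _), h.2.trans (min_le_right _ _)⟩
end

section
/- (Proposition 3: the rank-one Shor-strengthened relaxation is at least as strong as the matrix perspective relaxation, noisy case.) Let n, m ≥ 2, γ > 0, 𝓘 ⊆ [n]×[m], and A ∈ ℝ^{n×m}. Suppose X, W ∈ ℝ^{n×m}, Y a real symmetric n×n matrix with 0 ⪯ Y ⪯ I and tr(Y) ≤ 1, Θ a real symmetric positive semidefinite m×m matrix, and real numbers V¹_{i,(j₁,j₂)}, V²_{(i₁,i₂),j}, V³_{(i₁,i₂),(j₁,j₂)} satisfy: (i) the block matrix [[Y, X],[Xᵀ, Θ]] is positive semidefinite; (ii) for all i₁ < i₂ in [n] and j₁ < j₂ in [m], the 5×5 moment matrix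 with first row (1, X_{i₁,j₁}, X_{i₁,j₂}, X_{i₂,j₁}, X_{i₂,j₂}), diagonal (1, W_{i₁,j₁}, W_{i₁,j₂}, W_{i₂,j₁}, W_{i₂,j₂}), and off-diagonal entries given by V¹ (same row, two columns), V² (two rows, same column), V³ (cross terms) as in the paper's relaxation, is positive semidefinite; (iii) Θ_{j₁,j₂} = Σ_{i∈[n]} V¹_{i,(j₁,j₂)} for all j₁ < j₂, and Θ_{j,j} = Σ_{i∈[n]} W_{i,j} for all j. Then: (a) W_{i,j} ≥ X_{i,j}² for all (i,j) ∈ [n]×[m]; (b) the triple (X, Y, Θ) is feasible for the matrix perspective relaxation (i.e., [[Y, X],[Xᵀ, Θ]] ⪰ 0, 0 ⪯ Y ⪯ I, tr(Y) ≤ 1, Θ ⪰ 0); and (c) (1/(2γ))·tr(Θ) + (1/2)·Σ_{(i,j)∈𝓘} (A_{i,j}² − 2X_{i,j}A_{i,j} + W_{i,j}) ≥ (1/(2γ))·tr(Θ) + (1/2)·Σ_{(i,j)∈𝓘} (X_{i,j} − A_{i,j})². Hence the optimal value of the strengthened relaxation is at least that of the matrix perspective relaxation. -/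
open Matrix

/-- The 5×5 Shor moment matrix associated with the 2×2 minor `(i₁,i₂) × (j₁,j₂)` of `X`:
first row `(1, X_{i₁,j₁}, X_{i₁,j₂}, X_{i₂,j₁}, X_{i₂,j₂})`, diagonal
`(1, W_{i₁,j₁}, W_{i₁,j₂}, W_{i₂,j₁}, W_{i₂,j₂})`, and off-diagonal entries given by
`V¹` (same row, two columns), `V²` (two rows, same column), and `V³` (cross terms). -/
def shorMomentMatrix {n m : ℕ} (X W : Matrix (Fin n) (Fin m) ℝ)
    (V1 : Fin n → Fin m → Fin m → ℝ) (V2 : Fin n → Fin n → Fin m → ℝ)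
    (V3 : Fin n → Fin n → Fin m → Fin m → ℝ)
    (i₁ i₂ : Fin n) (j₁ j₂ : Fin m) : Matrix (Fin 5) (Fin 5) ℝ :=
  !![1,          X i₁ j₁,        X i₁ j₂,        X i₂ j₁,        X i₂ j₂;
     X i₁ j₁,    W i₁ j₁,        V1 i₁ j₁ j₂,    V2 i₁ i₂ j₁,    V3 i₁ i₂ j₁ j₂;
     X i₁ j₂,    V1 i₁ j₁ j₂,    W i₁ j₂,        V3 i₁ i₂ j₁ j₂, V2 i₁ i₂ j₂;
     X i₂ j₁,    V2 i₁ i₂ j₁,    V3 i₁ i₂ j₁ j₂, W i₂ j₁,        V1 i₂ j₁ j₂;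
     X i₂ j₂,    V3 i₁ i₂ j₁ j₂, V2 i₁ i₂ j₂,    V1 i₂ j₁ j₂,    W i₂ j₂]

theorem shor_aux_entry {M : Matrix (Fin 5) (Fin 5) ℝ} (h : M.PosSemidef) (k : Fin 5)
    (h0 : M 0 0 = 1) : M 0 k ^ 2 ≤ M k k := by
  have h1 := (h.submatrix ![0, k]).det_nonneg
  have h2 : M k 0 = M 0 k := by simpa using h.1.apply 0 k
  rw [Matrix.det_fin_two] at h1
  simp [h0, h2] at h1
  nlinarith

/-- Proposition 3 (noisy/matrix completion case): any feasible solution of the rank-one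
Shor-strengthened relaxation yields `W_{i,j} ≥ X_{i,j}²`, is feasible for the matrix
perspective relaxation, and its objective value dominates the matrix perspective
relaxation objective at `(X, Y, Θ)`; hence the strengthened relaxation is at least as
strong as the matrix perspective relaxation. -/
theorem shor_relaxation_stronger (n m : ℕ) (hn : 2 ≤ n) (hm : 2 ≤ m)
    (γ : ℝ) (hγ : 0 < γ) (Iobs : Finset (Fin n × Fin m))
    (A X W : Matrix (Fin n) (Fin m) ℝ)
    (Y : Matrix (Fin n) (Fin n) ℝ) (hYsymm : Y.IsSymm)
    (hYpsd : Y.PosSemidef) (hYI : (1 - Y).PosSemidef) (hYtr : Y.trace ≤ 1)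
    (Θ : Matrix (Fin m) (Fin m) ℝ) (hΘ : Θ.PosSemidef)
    (V1 : Fin n → Fin m → Fin m → ℝ) (V2 : Fin n → Fin n → Fin m → ℝ)
    (V3 : Fin n → Fin n → Fin m → Fin m → ℝ)
    (hblock : (Matrix.fromBlocks Y X Xᵀ Θ).PosSemidef)
    (hmoment : ∀ (i₁ i₂ : Fin n) (j₁ j₂ : Fin m), i₁ < i₂ → j₁ < j₂ →
      (shorMomentMatrix X W V1 V2 V3 i₁ i₂ j₁ j₂).PosSemidef)
    (hΘoff : ∀ j₁ j₂ : Fin m, j₁ < j₂ → Θ j₁ j₂ = ∑ i, V1 i j₁ j₂)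
    (hΘdiag : ∀ j : Fin m, Θ j j = ∑ i, W i j) :
    (∀ (i : Fin n) (j : Fin m), X i j ^ 2 ≤ W i j) ∧
    ((Matrix.fromBlocks Y X Xᵀ Θ).PosSemidef ∧ Y.PosSemidef ∧ (1 - Y).PosSemidef ∧
      Y.trace ≤ 1 ∧ Θ.PosSemidef) ∧
    (1 / (2 * γ)) * Θ.trace
        + (1 / 2) * ∑ p ∈ Iobs, (X p.1 p.2 - A p.1 p.2) ^ 2
      ≤ (1 / (2 * γ)) * Θ.trace
        + (1 / 2) * ∑ p ∈ Iobs, (A p.1 p.2 ^ 2 - 2 * X p.1 p.2 * A p.1 p.2 + W p.1 p.2) := by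
  have key : ∀ (i : Fin n) (j : Fin m), X i j ^ 2 ≤ W i j := by
    intro i j
    have : Nontrivial (Fin n) := Fin.nontrivial_iff_two_le.mpr hn
    have : Nontrivial (Fin m) := Fin.nontrivial_iff_two_le.mpr hm
    obtain ⟨i', hi⟩ := exists_ne i
    obtain ⟨j', hj⟩ := exists_ne j
    rcases lt_or_gt_of_ne hi with hi | hi <;> rcases lt_or_gt_of_ne hj with hj | hj
    · exact shor_aux_entry (hmoment i' i j' j hi hj) 4 rfl
    · exact shor_aux_entry (hmoment i' i j j' hi hj) 3 rfl
    · exact shor_aux_entry (hmoment i i' j' j hi hj) 2 rfl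
    · exact shor_aux_entry (hmoment i i' j j' hi hj) 1 rfl
  refine ⟨key, ⟨hblock, hYpsd, hYI, hYtr, hΘ⟩, ?_⟩
  have hsum : ∑ p ∈ Iobs, (X p.1 p.2 - A p.1 p.2) ^ 2
      ≤ ∑ p ∈ Iobs, (A p.1 p.2 ^ 2 - 2 * X p.1 p.2 * A p.1 p.2 + W p.1 p.2) := by
    apply Finset.sum_le_sum
    intro p _
    nlinarith [key p.1 p.2]
  linarith
end

section
/- (Key separation inequality in the proof of Theorem 1.) Let n ≥ k ≥ 1 and ε > 0. Let x ∈ ℝⁿ with ‖x‖₂ = 1, let Y_l, Y_L be real symmetric n×n matrices, and let U_l, U_L ∈ ℝ^{n×k} with columns U_l^t, U_L^t (t ∈ [k]) such that |xᵀU_l^t| ≤ 1 for all t. Assume (i) Σ_{t=1}^k [ (xᵀU_l^t)(xᵀU_L^t) + |xᵀ(U_l^t − U_L^t)| ] ≥ xᵀ Y_L x, and (ii) xᵀ Y_l x − Σ_{t=1}^k (xᵀ U_l^t)² > ε. Then ‖Y_l − Y_L‖_F + 2√n · ‖U_l − U_L‖_F > ε. -/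
open Matrix

/-- Key separation inequality in the proof of Theorem 1: if `(Y_L, U_L)` satisfies the
eigenvector disjunction generated at iterate `l` (hypothesis `h1`) while `(Y_l, U_l)` is
`ε`-infeasible at the unit vector `x` (hypothesis `h2`), then
`‖Y_l − Y_L‖_F + 2√n ‖U_l − U_L‖_F > ε`. -/
theorem separation_inequality (n k : ℕ) (hk : 1 ≤ k) (hkn : k ≤ n) (ε : ℝ) (hε : 0 < ε)
    (x : Fin n → ℝ) (hx : Real.sqrt (∑ i, x i ^ 2) = 1)
    (Yl YL : Matrix (Fin n) (Fin n) ℝ) (hYl : Yl.IsSymm) (hYL : YL.IsSymm)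
    (Ul UL : Matrix (Fin n) (Fin k) ℝ)
    (hbound : ∀ t : Fin k, |x ⬝ᵥ (fun i => Ul i t)| ≤ 1)
    (h1 : x ⬝ᵥ YL.mulVec x ≤
      ∑ t, ((x ⬝ᵥ (fun i => Ul i t)) * (x ⬝ᵥ (fun i => UL i t))
        + |x ⬝ᵥ (fun i => Ul i t - UL i t)|))
    (h2 : ε < x ⬝ᵥ Yl.mulVec x - ∑ t, (x ⬝ᵥ (fun i => Ul i t)) ^ 2) :
    ε < Real.sqrt (∑ i, ∑ j, (Yl i j - YL i j) ^ 2)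
      + 2 * Real.sqrt n * Real.sqrt (∑ i, ∑ t, (Ul i t - UL i t) ^ 2) := by
  have hx2 : ∑ i, x i ^ 2 = 1 := by
    rwa [Real.sqrt_eq_one] at hx
  have key : ∀ v : Fin n → ℝ, (x ⬝ᵥ v) ^ 2 ≤ ∑ i, v i ^ 2 := by
    intro v
    have h := Finset.sum_mul_sq_le_sq_mul_sq Finset.univ x v
    rw [hx2, one_mul] at h
    exact h
  have hY : x ⬝ᵥ Yl.mulVec x - x ⬝ᵥ YL.mulVec x
      ≤ Real.sqrt (∑ i, ∑ j, (Yl i j - YL i j) ^ 2) := by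
    apply Real.le_sqrt_of_sq_le
    rw [← dotProduct_sub, ← Matrix.sub_mulVec]
    refine (key _).trans (Finset.sum_le_sum fun i _ => ?_)
    have h := key (fun j => Yl i j - YL i j)
    rw [dotProduct_comm] at h
    exact h
  have hd : ∀ t : Fin k, x ⬝ᵥ (fun i => Ul i t - UL i t)
      = x ⬝ᵥ (fun i => Ul i t) - x ⬝ᵥ (fun i => UL i t) := by
    intro t
    rw [← dotProduct_sub]
    rfl
  have hS : ∑ t, |x ⬝ᵥ (fun i => Ul i t - UL i t)|
      ≤ Real.sqrt n * Real.sqrt (∑ i, ∑ t, (Ul i t - UL i t) ^ 2) := by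
    rw [← Real.sqrt_mul (Nat.cast_nonneg n)]
    apply Real.le_sqrt_of_sq_le
    have h := sq_sum_le_card_mul_sum_sq (s := Finset.univ)
      (f := fun t : Fin k => |x ⬝ᵥ (fun i => Ul i t - UL i t)|)
    refine h.trans ?_
    rw [Finset.card_univ, Fintype.card_fin, Finset.sum_comm]
    have hkn' : (k : ℝ) ≤ n := by exact_mod_cast hkn
    refine mul_le_mul hkn' (Finset.sum_le_sum fun t _ => ?_)
      (Finset.sum_nonneg fun t _ => sq_nonneg _) (Nat.cast_nonneg n)
    rw [sq_abs]
    exact key _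
  have hT : ∑ t, ((x ⬝ᵥ (fun i => Ul i t)) * (x ⬝ᵥ (fun i => UL i t))
        + |x ⬝ᵥ (fun i => Ul i t - UL i t)|) - ∑ t, (x ⬝ᵥ (fun i => Ul i t)) ^ 2
      ≤ 2 * ∑ t, |x ⬝ᵥ (fun i => Ul i t - UL i t)| := by
    rw [← Finset.sum_sub_distrib, Finset.mul_sum]
    refine Finset.sum_le_sum fun t _ => ?_
    have hb := hbound t
    rw [hd t]
    generalize x ⬝ᵥ (fun i => Ul i t) = a at *
    generalize x ⬝ᵥ (fun i => UL i t) = b at *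
    have h3 : -(a * (a - b)) ≤ |a| * |a - b| := by
      rw [← abs_mul]
      exact neg_le_abs _
    have h4 : |a| * |a - b| ≤ 1 * |a - b| :=
      mul_le_mul_of_nonneg_right hb (abs_nonneg _)
    linarith
  linarith
end

section
/- (Theorem 1, finite-convergence form.) Let n ≥ k ≥ 1 and ε > 0. There is no infinite sequence (Y_t, U_t, x_t)_{t∈ℕ}, where each Y_t is a real symmetric n×n matrix, U_t ∈ ℝ^{n×k} with columns U_t^j, and x_t ∈ ℝⁿ with ‖x_t‖₂ = 1, satisfying for every t: (i) 0 ⪯ Y_t ⪯ I, tr(Y_t) ≤ k, and U_t U_tᵀ ⪯ Y_t; (ii) x_tᵀ (Y_t − U_t U_tᵀ) x_t > ε (ε-infeasibility); and (iii) for every l < t, Σ_{j=1}^k [ (x_lᵀ U_l^j)(x_lᵀ U_t^j) + |x_lᵀ(U_l^j − U_t^j)| ] ≥ x_lᵀ Y_t x_l (the eigenvector disjunction generated at iterate l is satisfied at iterate t). Consequently, the disjunctive cutting procedure of the paper reaches, after finitely many iterations, an iterate with λ_min(U U ᵀ − Y) ≥ −ε. -/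
open Matrix

lemma fc_entry {n : ℕ} {Y : Matrix (Fin n) (Fin n) ℝ} (hs : Y.IsSymm) (h0 : Y.PosSemidef)
    (h1 : (1 - Y).PosSemidef) (i j : Fin n) : -1 ≤ Y i j ∧ Y i j ≤ 1 := by
  have hd : ∀ i, Y i i ≤ 1 := fun i => by
    have := h1.diag_nonneg (i := i)
    simp at this
    exact this
  have hp := h0.dotProduct_mulVec_nonneg (Pi.single i 1 + Pi.single j 1)
  have hm := h0.dotProduct_mulVec_nonneg (Pi.single i 1 - Pi.single j 1)
  have hji : Y j i = Y i j := hs.apply i j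
  simp [Matrix.mulVec_add, Matrix.mulVec_sub, add_dotProduct, sub_dotProduct, hji] at hp hm
  have := hd i
  have := hd j
  constructor <;> linarith

lemma fc_entryU {n k : ℕ} {Y : Matrix (Fin n) (Fin n) ℝ} {U : Matrix (Fin n) (Fin k) ℝ}
    (h1 : (1 - Y).PosSemidef) (h2 : (Y - U * Uᵀ).PosSemidef) (i : Fin n) (j : Fin k) :
    -1 ≤ U i j ∧ U i j ≤ 1 := by
  have a := h1.diag_nonneg (i := i)
  have b := h2.diag_nonneg (i := i)
  simp [Matrix.mul_apply] at a b
  have c : U i j * U i j ≤ ∑ j, U i j * U i j :=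
    Finset.single_le_sum (f := fun j => U i j * U i j)
      (fun j _ => mul_self_nonneg _) (Finset.mem_univ j)
  constructor <;> nlinarith

lemma fc_quad {n k : ℕ} (U : Matrix (Fin n) (Fin k) ℝ) (x : Fin n → ℝ) :
    x ⬝ᵥ (U * Uᵀ).mulVec x =
      ∑ j, (x ⬝ᵥ (fun i => U i j)) * (x ⬝ᵥ (fun i => U i j)) := by
  rw [← Matrix.mulVec_mulVec, Matrix.dotProduct_mulVec, Matrix.mulVec_transpose]
  rfl

/-- Theorem 1 (finite-convergence form): there is no infinite sequence of iterates
`(Y_t, U_t, x_t)` that are feasible for the matrix perspective relaxation (i),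
`ε`-infeasible at the unit eigenvector `x_t` (ii), and satisfy every previously
generated eigenvector disjunction (iii). Hence the disjunctive cutting procedure
terminates after finitely many iterations with `λ_min(UUᵀ − Y) ≥ −ε`. -/
theorem finite_convergence (n k : ℕ) (hk : 1 ≤ k) (hkn : k ≤ n) (ε : ℝ) (hε : 0 < ε) :
    ¬ ∃ (Y : ℕ → Matrix (Fin n) (Fin n) ℝ) (U : ℕ → Matrix (Fin n) (Fin k) ℝ)
        (x : ℕ → Fin n → ℝ),
      (∀ t, (Y t).IsSymm) ∧
      (∀ t, Real.sqrt (∑ i, x t i ^ 2) = 1) ∧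
      (∀ t, (Y t).PosSemidef ∧ (1 - Y t).PosSemidef ∧ (Y t).trace ≤ (k : ℝ) ∧
        (Y t - U t * (U t)ᵀ).PosSemidef) ∧
      (∀ t, ε < x t ⬝ᵥ (Y t - U t * (U t)ᵀ).mulVec (x t)) ∧
      (∀ l t, l < t →
        x l ⬝ᵥ (Y t).mulVec (x l) ≤
          ∑ j, ((x l ⬝ᵥ (fun i => U l i j)) * (x l ⬝ᵥ (fun i => U t i j))
            + |x l ⬝ᵥ (fun i => U l i j - U t i j)|)) := by
  rintro ⟨Y, U, x, hs, hx, hf, he, hc⟩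
  have hxb : ∀ t i, -1 ≤ x t i ∧ x t i ≤ 1 := by
    intro t i
    have h : ∑ i, x t i ^ 2 = 1 := by simpa using hx t
    have c : x t i ^ 2 ≤ ∑ i, x t i ^ 2 :=
      Finset.single_le_sum (f := fun i => x t i ^ 2)
        (fun i _ => sq_nonneg _) (Finset.mem_univ i)
    constructor <;> nlinarith
  let p : ℕ → (Fin n → Fin n → ℝ) × (Fin n → Fin k → ℝ) × (Fin n → ℝ) :=
    fun t => (fun i j => Y t i j, fun i j => U t i j, x t)
  have hK : IsCompact ((Set.Icc (fun _ _ => -1) (fun _ _ => 1) : Set (Fin n → Fin n → ℝ)) ×ˢ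
      ((Set.Icc (fun _ _ => -1) (fun _ _ => 1) : Set (Fin n → Fin k → ℝ)) ×ˢ
        (Set.Icc (fun _ => -1) (fun _ => 1) : Set (Fin n → ℝ)))) :=
    isCompact_Icc.prod (isCompact_Icc.prod isCompact_Icc)
  obtain ⟨⟨Y', U', x'⟩, -, φ, hφ, hl⟩ := hK.tendsto_subseq (x := p) (fun t =>
    ⟨⟨fun i j => (fc_entry (hs t) (hf t).1 (hf t).2.1 i j).1,
      fun i j => (fc_entry (hs t) (hf t).1 (hf t).2.1 i j).2⟩,
      ⟨fun i j => (fc_entryU (hf t).2.1 (hf t).2.2.2 i j).1,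
      fun i j => (fc_entryU (hf t).2.1 (hf t).2.2.2 i j).2⟩,
      ⟨fun i => (hxb t i).1, fun i => (hxb t i).2⟩⟩)
  have hl2 := hl.comp (Filter.tendsto_add_atTop_nat 1)
  -- pointwise limits
  have hq := hl.prodMk_nhds hl2
  let F : ((Fin n → Fin n → ℝ) × (Fin n → Fin k → ℝ) × (Fin n → ℝ)) ×
      ((Fin n → Fin n → ℝ) × (Fin n → Fin k → ℝ) × (Fin n → ℝ)) → ℝ := fun z =>
    ∑ j, ((∑ i, z.1.2.2 i * z.1.2.1 i j) * (∑ i, z.1.2.2 i * z.2.2.1 i j)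
      + |∑ i, z.1.2.2 i * (z.1.2.1 i j - z.2.2.1 i j)|)
      - ∑ i, z.1.2.2 i * ∑ j, z.2.1 i j * z.1.2.2 j
  let G : ((Fin n → Fin n → ℝ) × (Fin n → Fin k → ℝ) × (Fin n → ℝ)) → ℝ := fun z =>
    ∑ i, z.2.2 i * ∑ j, z.1 i j * z.2.2 j
      - ∑ j, (∑ i, z.2.2 i * z.2.1 i j) * (∑ i, z.2.2 i * z.2.1 i j)
  have hF : Continuous F := by fun_prop
  have hG : Continuous G := by fun_prop
  have h1 : 0 ≤ F ((Y', U', x'), (Y', U', x')) := by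
    refine ge_of_tendsto' ((hF.tendsto _).comp hq) (fun m => ?_)
    exact sub_nonneg.2 (hc (φ m) (φ (m + 1)) (hφ (Nat.lt_succ_self m)))
  have h2 : ε ≤ G (Y', U', x') := by
    refine ge_of_tendsto' ((hG.tendsto _).comp hl) (fun m => ?_)
    have h := he (φ m)
    rw [Matrix.sub_mulVec, dotProduct_sub, fc_quad] at h
    exact h.le
  simp [F, G] at h1 h2
  linarith
end

section
/- (Lemma 2, part 1: row supports after rank-one presolve are equal or disjoint.) Let n, m ≥ 1 and let 𝓘 ⊆ [n]×[m] be such that for all i₁ ≠ i₂ in [n] and j₁ ≠ j₂ in [m], the number of elements of 𝓘 in {i₁,i₂}×{j₁,j₂} is not exactly 3 (i.e., 𝓘 is a fixed point of the rank-one presolve procedure). For i ∈ [n], write 𝓘(i,:) := {j ∈ [m] : (i,j) ∈ 𝓘}. Then for all i₁, i₂ ∈ [n], either 𝓘(i₁,:) = 𝓘(i₂,:) or 𝓘(i₁,:) ∩ 𝓘(i₂,:) = ∅. Symmetrically, writing 𝓘(:,j) := {i ∈ [n] : (i,j) ∈ 𝓘}, for all j₁, j₂ ∈ [m], either 𝓘(:,j₁)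 = 𝓘(:,j₂) or 𝓘(:,j₁) ∩ 𝓘(:,j₂) = ∅. -/
open Set

/-- Lemma 2, part 1: if `I` is a fixed point of the rank-one presolve procedure (no 2×2
submatrix has exactly 3 of its 4 entries observed), then row supports are equal or
disjoint, and likewise for column supports. -/
theorem rank_one_presolve_rows (n m : ℕ) (hn : 1 ≤ n) (hm : 1 ≤ m)
    (I : Set (Fin n × Fin m))
    (hfix : ∀ i₁ i₂ : Fin n, ∀ j₁ j₂ : Fin m, i₁ ≠ i₂ → j₁ ≠ j₂ →
      (I ∩ (({i₁, i₂} : Set (Fin n)) ×ˢ ({j₁, j₂} : Set (Fin m)))).ncard ≠ 3) :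
    (∀ i₁ i₂ : Fin n,
      {j : Fin m | (i₁, j) ∈ I} = {j : Fin m | (i₂, j) ∈ I} ∨
      {j : Fin m | (i₁, j) ∈ I} ∩ {j : Fin m | (i₂, j) ∈ I} = ∅) ∧
    (∀ j₁ j₂ : Fin m,
      {i : Fin n | (i, j₁) ∈ I} = {i : Fin n | (i, j₂) ∈ I} ∨
      {i : Fin n | (i, j₁) ∈ I} ∩ {i : Fin n | (i, j₂) ∈ I} = ∅) := by
  have key : ∀ (a c : Fin n) (b d : Fin m), (a, b) ∈ I → (a, d) ∈ I → (c, b) ∈ I →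
      (c, d) ∈ I := by
    intro a c b d h1 h2 h3
    by_contra h4
    have hac : a ≠ c := by
      rintro rfl
      exact h4 h2
    have hbd : b ≠ d := by
      rintro rfl
      exact h4 h3
    apply hfix a c b d hac hbd
    rw [Set.ncard_eq_three]
    refine ⟨(a, b), (a, d), (c, b), ?_, ?_, ?_, ?_⟩
    · simp [hbd]
    · simp [hac]
    · simp [hac]
    · ext ⟨x, y⟩
      simp only [Set.mem_inter_iff, Set.mem_prod, Set.mem_insert_iff, Set.mem_singleton_iff,
        Prod.mk.injEq]
      constructor
      · rintro ⟨h, rfl | rfl, rfl | rfl⟩ <;> simp_all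
      · rintro (⟨rfl, rfl⟩ | ⟨rfl, rfl⟩ | ⟨rfl, rfl⟩) <;> simp_all
  constructor
  · intro i₁ i₂
    rcases Set.eq_empty_or_nonempty
      ({j : Fin m | (i₁, j) ∈ I} ∩ {j : Fin m | (i₂, j) ∈ I}) with h | ⟨b, hb1, hb2⟩
    · exact Or.inr h
    · left
      ext d
      exact ⟨fun h => key i₁ i₂ b d hb1 h hb2, fun h => key i₂ i₁ b d hb2 h hb1⟩
  · intro j₁ j₂
    rcases Set.eq_empty_or_nonempty
      ({i : Fin n | (i, j₁) ∈ I} ∩ {i : Fin n | (i, j₂) ∈ I}) with h | ⟨a, ha1, ha2⟩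
    · exact Or.inr h
    · left
      ext c
      exact ⟨fun h => key a c j₁ j₂ ha1 ha2 h, fun h => key a c j₂ j₁ ha2 ha1 h⟩
end

section
/- (Lemma 2, part 2: block-rectangular structure after rank-one presolve.) Let n, m ≥ 1 and let 𝓘 ⊆ [n]×[m] be such that for all i₁ ≠ i₂ in [n] and j₁ ≠ j₂ in [m], the number of elements of 𝓘 in {i₁,i₂}×{j₁,j₂} is not exactly 3. Assume moreover that every row and every column contains at least one observed entry: 𝓘(i,:) ≠ ∅ for all i ∈ [n] and 𝓘(:,j) ≠ ∅ for all j ∈ [m]. Then there exist an integer s ≥ 1 and nonempty sets R₁,…,R_s partitioning [n] and nonempty sets C₁,…,C_s partitioning [m] such that 𝓘 = (R₁×C₁) ∪ (R₂×C₂) ∪ … ∪ (R_s×C_s). -/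
open Set

/-- Lemma 2, part 2: if `I` is a fixed point of the rank-one presolve procedure and every
row and column contains an observed entry, then `I` has a block-rectangular structure:
`I = (R₁ × C₁) ∪ ⋯ ∪ (R_s × C_s)` where the `Rᵢ` partition the rows and the `Cᵢ`
partition the columns into nonempty sets. -/
theorem rank_one_presolve_block_structure (n m : ℕ) (hn : 1 ≤ n) (hm : 1 ≤ m)
    (I : Set (Fin n × Fin m))
    (hfix : ∀ i₁ i₂ : Fin n, ∀ j₁ j₂ : Fin m, i₁ ≠ i₂ → j₁ ≠ j₂ →
      (I ∩ (({i₁, i₂} : Set (Fin n)) ×ˢ ({j₁, j₂} : Set (Fin m)))).ncard ≠ 3)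
    (hrow : ∀ i : Fin n, {j : Fin m | (i, j) ∈ I}.Nonempty)
    (hcol : ∀ j : Fin m, {i : Fin n | (i, j) ∈ I}.Nonempty) :
    ∃ (s : ℕ), 1 ≤ s ∧ ∃ (R : Fin s → Set (Fin n)) (C : Fin s → Set (Fin m)),
      (∀ t, (R t).Nonempty) ∧ (∀ t, (C t).Nonempty) ∧
      (Pairwise fun t t' => Disjoint (R t) (R t')) ∧
      (Pairwise fun t t' => Disjoint (C t) (C t')) ∧
      (⋃ t, R t) = Set.univ ∧ (⋃ t, C t) = Set.univ ∧
      I = ⋃ t, (R t) ×ˢ (C t) := by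
  have key : ∀ i i' j j', (i, j) ∈ I → (i', j) ∈ I → (i, j') ∈ I → (i', j') ∈ I := by
    intro i i' j j' h1 h2 h3
    by_contra h4
    have hi : i ≠ i' := by rintro rfl; exact h4 h3
    have hj : j ≠ j' := by rintro rfl; exact h4 h2
    apply hfix i i' j j' hi hj
    have : I ∩ (({i, i'} : Set (Fin n)) ×ˢ ({j, j'} : Set (Fin m)))
        = {(i, j), (i', j), (i, j')} := by
      ext ⟨a, b⟩
      simp only [mem_inter_iff, mem_prod, mem_insert_iff, mem_singleton_iff, Prod.mk.injEq]
      constructor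
      · rintro ⟨h, rfl | rfl, rfl | rfl⟩ <;> simp_all
      · rintro (⟨rfl, rfl⟩ | ⟨rfl, rfl⟩ | ⟨rfl, rfl⟩) <;> simp_all
    rw [this, Set.ncard_eq_three]
    exact ⟨_, _, _, by simp [hi], by simp [hj], by simp [hj], rfl⟩
  let f : Fin n → Set (Fin m) := fun i => {j | (i, j) ∈ I}
  have hf : ∀ i i' j, j ∈ f i → j ∈ f i' → f i = f i' := by
    intro i i' j h h'
    ext k
    exact ⟨fun hk => key i i' j k h h' hk, fun hk => key i' i j k h' h hk⟩
  obtain ⟨s, ⟨e⟩⟩ := Finite.exists_equiv_fin (Set.range f)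
  have hs : ∀ t : Fin s, ∃ i, f i = (e.symm t).1 := fun t => (e.symm t).2
  have he : ∀ i, ((e.symm (e ⟨f i, i, rfl⟩)).1 : Set (Fin m)) = f i := by simp
  refine ⟨s, ?_, fun t => {i | f i = (e.symm t).1}, fun t => (e.symm t).1, hs, ?_, ?_, ?_, ?_,
    ?_, ?_⟩
  · have := (e ⟨f ⟨0, hn⟩, _, rfl⟩).2
    omega
  · intro t
    obtain ⟨i, hi⟩ := hs t
    simp only [← hi]
    exact hrow i
  · intro t t' htt
    rw [Set.disjoint_left]
    intro i h h'
    exact htt (e.symm.injective (Subtype.ext (h.symm.trans h')))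
  · intro t t' htt
    rw [Set.disjoint_left]
    intro j h h'
    obtain ⟨i, hi⟩ := hs t
    obtain ⟨i', hi'⟩ := hs t'
    simp only [← hi, ← hi'] at h h'
    exact htt (e.symm.injective (Subtype.ext (hi.symm.trans ((hf i i' j h h').trans hi'))))
  · rw [Set.eq_univ_iff_forall]
    intro i
    exact Set.mem_iUnion.2 ⟨e ⟨f i, i, rfl⟩, (he i).symm⟩
  · rw [Set.eq_univ_iff_forall]
    intro j
    obtain ⟨i, hi⟩ := hcol j
    refine Set.mem_iUnion.2 ⟨e ⟨f i, i, rfl⟩, ?_⟩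
    rw [he i]
    exact hi
  · ext ⟨i, j⟩
    rw [Set.mem_iUnion]
    constructor
    · intro h
      refine ⟨e ⟨f i, i, rfl⟩, (he i).symm, ?_⟩
      simp only [he i]
      exact h
    · rintro ⟨t, h1, h2⟩
      have h1' : f i = (e.symm t).1 := h1
      have h2' : j ∈ (e.symm t).1 := h2
      rw [← h1'] at h2'
      exact h2'
end

section
/- (Lemma 3: structure after rank-k presolve.) Let n, m, k ≥ 1 and let 𝓘 ⊆ [n]×[m] be such that for all R ⊆ [n] and C ⊆ [m] with |R| = |C| = k+1, the number of elements of 𝓘 in R×C is not exactly (k+1)² − 1 (i.e., 𝓘 is a fixed point of the rank-k presolve procedure). For R ⊆ [n], write 𝓘(R,:) := {j ∈ [m] : (i,j) ∈ 𝓘 for all i ∈ R}. Then for all R₁, R₂ ⊆ [n] with |R₁| = |R₂| = k: either 𝓘(R₁,:) = 𝓘(R₂,:) or |𝓘(R₁ ∪ R₂,:)| < k. Symmetrically, for C ⊆ [m] with 𝓘(:,C) := {i ∈ [n] : (i,j) ∈ 𝓘 for all j ∈ C}, for all C₁, C₂ ⊆ [m] with |C₁| = |C₂| = k: either 𝓘(:,C₁)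 = 𝓘(:,C₂) or |𝓘(:,C₁ ∪ C₂)| < k. -/
open Set

theorem presolve_core {α β : Type*} [DecidableEq α] [DecidableEq β] [Finite β]
    (k : ℕ) (P : α → β → Prop)
    (h : ∀ (R : Finset α) (C : Finset β), R.card = k + 1 → C.card = k + 1 →
      ∀ a ∈ R, ∀ b ∈ C, ¬ P a b →
        ¬ (∀ x ∈ R, ∀ y ∈ C, (x = a ∧ y = b) ∨ P x y))
    (R₁ R₂ : Finset α) (h₁ : R₁.card = k)
    (hS : k ≤ {j : β | ∀ i ∈ R₁ ∪ R₂, P i j}.ncard) (j : β) (hj : ∀ i ∈ R₁, P i j) :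
    ∀ i ∈ R₂, P i j := by
  intro i hi
  by_contra hP
  have hiR : i ∉ R₁ := fun hh => hP (hj i hh)
  obtain ⟨T, hTS, hT⟩ := Set.exists_subset_card_eq hS
  have hTf : T.Finite := Set.toFinite T
  have hTc : hTf.toFinset.card = k := by rw [← hT, Set.ncard_eq_toFinset_card T hTf]
  have hall : ∀ y ∈ hTf.toFinset, ∀ x ∈ R₁ ∪ R₂, P x y := by
    intro y hy
    exact hTS (by simpa using hy)
  have hjT : j ∉ hTf.toFinset := fun hh => hP (hall j hh i (Finset.mem_union_right _ hi))
  refine h (insert i R₁) (insert j hTf.toFinset)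
    (by rw [Finset.card_insert_of_notMem hiR, h₁])
    (by rw [Finset.card_insert_of_notMem hjT, hTc])
    i (Finset.mem_insert_self _ _) j (Finset.mem_insert_self _ _) hP ?_
  intro x hx y hy
  rcases Finset.mem_insert.1 hx with rfl | hx <;> rcases Finset.mem_insert.1 hy with rfl | hy
  · exact Or.inl ⟨rfl, rfl⟩
  · exact Or.inr (hall y hy _ (Finset.mem_union_right _ hi))
  · exact Or.inr (hj x hx)
  · exact Or.inr (hall y hy _ (Finset.mem_union_left _ hx))

theorem presolve_both {α β : Type*} [DecidableEq α] [DecidableEq β] [Finite β]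
    (k : ℕ) (P : α → β → Prop)
    (h : ∀ (R : Finset α) (C : Finset β), R.card = k + 1 → C.card = k + 1 →
      ∀ a ∈ R, ∀ b ∈ C, ¬ P a b →
        ¬ (∀ x ∈ R, ∀ y ∈ C, (x = a ∧ y = b) ∨ P x y))
    (R₁ R₂ : Finset α) (h₁ : R₁.card = k) (h₂ : R₂.card = k) :
    {j : β | ∀ i ∈ R₁, P i j} = {j : β | ∀ i ∈ R₂, P i j} ∨
      {j : β | ∀ i ∈ R₁ ∪ R₂, P i j}.ncard < k := by
  by_cases hS : {j : β | ∀ i ∈ R₁ ∪ R₂, P i j}.ncard < k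
  · exact Or.inr hS
  · left
    have hS := not_lt.1 hS
    ext j
    exact ⟨presolve_core k P h R₁ R₂ h₁ hS j,
      presolve_core k P h R₂ R₁ h₂ (by rwa [Finset.union_comm]) j⟩

/-- Lemma 3: if `I` is a fixed point of the rank-`k` presolve procedure (no
`(k+1)×(k+1)` submatrix has exactly `(k+1)² − 1` of its entries observed), then for any
two `k`-element row sets `R₁, R₂`, either their common column supports coincide, or the
common column support of `R₁ ∪ R₂` has fewer than `k` elements; symmetrically for
column sets. -/
theorem rank_k_presolve_structure (n m k : ℕ) (hn : 1 ≤ n) (hm : 1 ≤ m) (hk : 1 ≤ k)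
    (I : Set (Fin n × Fin m))
    (hfix : ∀ (R : Finset (Fin n)) (C : Finset (Fin m)),
      R.card = k + 1 → C.card = k + 1 →
      (I ∩ ((R : Set (Fin n)) ×ˢ (C : Set (Fin m)))).ncard ≠ (k + 1) ^ 2 - 1) :
    (∀ R₁ R₂ : Finset (Fin n), R₁.card = k → R₂.card = k →
      ({j : Fin m | ∀ i ∈ R₁, (i, j) ∈ I} = {j : Fin m | ∀ i ∈ R₂, (i, j) ∈ I} ∨
        {j : Fin m | ∀ i ∈ R₁ ∪ R₂, (i, j) ∈ I}.ncard < k)) ∧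
    (∀ C₁ C₂ : Finset (Fin m), C₁.card = k → C₂.card = k →
      ({i : Fin n | ∀ j ∈ C₁, (i, j) ∈ I} = {i : Fin n | ∀ j ∈ C₂, (i, j) ∈ I} ∨
        {i : Fin n | ∀ j ∈ C₁ ∪ C₂, (i, j) ∈ I}.ncard < k)) := by
  have key : ∀ (R : Finset (Fin n)) (C : Finset (Fin m)), R.card = k + 1 → C.card = k + 1 →
      ∀ a ∈ R, ∀ b ∈ C, (a, b) ∉ I →
        ¬ (∀ x ∈ R, ∀ y ∈ C, (x = a ∧ y = b) ∨ (x, y) ∈ I) := by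
    intro R C hR hC a ha b hb hab hall
    apply hfix R C hR hC
    have he : I ∩ ((R : Set (Fin n)) ×ˢ (C : Set (Fin m))) =
        (((R ×ˢ C).erase (a, b) : Finset (Fin n × Fin m)) : Set (Fin n × Fin m)) := by
      ext ⟨x, y⟩
      simp only [Set.mem_inter_iff, Set.mem_prod, Finset.mem_coe, Finset.mem_erase,
        Finset.mem_product, ne_eq, Prod.mk.injEq]
      constructor
      · rintro ⟨hI, hx, hy⟩
        refine ⟨?_, hx, hy⟩
        rintro ⟨rfl, rfl⟩
        exact hab hI
      · rintro ⟨hne, hx, hy⟩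
        exact ⟨(hall x hx y hy).resolve_left hne, hx, hy⟩
    rw [he, Set.ncard_coe_finset, Finset.card_erase_of_mem (Finset.mk_mem_product ha hb),
      Finset.card_product, hR, hC, sq]
  refine ⟨fun R₁ R₂ h₁ h₂ => presolve_both k (fun i j => (i, j) ∈ I) key R₁ R₂ h₁ h₂,
    fun C₁ C₂ h₁ h₂ => presolve_both k (fun j i => (i, j) ∈ I) ?_ C₁ C₂ h₁ h₂⟩
  intro C R hC hR b hb a ha hab hall
  exact key R C hR hC a ha b hb hab fun x hx y hy => (hall y hy x hx).imp_left And.symm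
end
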